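/- arXiv:1406.2918 — 2 statements merged into one kernel-verified Lean document; each statement's English description precedes it below -/
import Mathlib

section
/- For every real constant C > 0 there exist constants K > 0 and ρ₀ > 0 (depending only on C) such that for every real ρ ≥ ρ₀ and every real x with ρ - C ρ^{1/3} (log ρ)^{1/3} ≤ x ≤ ρ - C ρ^{1/3}, one has |J_ρ(x)| ≤ K · ρ^{-1/3}. -/
/-- The Bessel function of the first kind `J_ρ(x)` for real order `ρ > 0` and `x > 0`,
defined by the series `∑_{m≥0} (-1)^m (x/2)^{2m+ρ} / (Γ(m+1) Γ(m+ρ+1))`. -/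
noncomputable def besselJ (ρ x : ℝ) : ℝ :=
  ∑' m : ℕ, (-1 : ℝ) ^ m * (x / 2) ^ (2 * (m : ℝ) + ρ) /
    (Real.Gamma ((m : ℝ) + 1) * Real.Gamma ((m : ℝ) + ρ + 1))

theorem le_log_Gamma_stirling {ρ : ℝ} (hρ : 1 < ρ) :
    (ρ + 1 / 2) * Real.log ρ - ρ ≤ Real.log (Real.Gamma (ρ + 1)) + 3 / 2 := by
  obtain ⟨n, hn⟩ : ∃ n : ℕ, ⌈ρ⌉₊ = n + 1 :=
    Nat.exists_eq_add_one.mpr (Nat.ceil_pos.mpr (by linarith))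
  have h1 : (n : ℝ) < ρ := Nat.lt_ceil.mp (by omega)
  have h2 : ρ ≤ n + 1 := by
    have := Nat.le_ceil ρ
    rw [hn] at this
    exact_mod_cast this
  have hn1 : 1 ≤ n := by
    by_contra! h0
    have : n = 0 := by omega
    simp [this] at h2
    linarith
  have hn1' : (1 : ℝ) ≤ n := by exact_mod_cast hn1
  set s := ρ - n with hs
  have hG := Real.BohrMollerup.f_add_nat_ge (n := n + 1) (x := s) Real.convexOn_log_Gamma
    (fun {y} hy => by
      simp only [Function.comp_apply]
      rw [Real.Gamma_add_one hy.ne', Real.log_mul hy.ne' (Real.Gamma_pos_of_pos hy).ne', add_comm])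
    (by omega) (by linarith)
  have hS := Stirling.le_log_factorial_stirling (n := n) (by omega)
  simp only [Function.comp_apply, Nat.cast_add, Nat.cast_one, add_sub_cancel_right,
    Real.Gamma_nat_eq_factorial] at hG
  rw [show (n : ℝ) + 1 + s = ρ + 1 by rw [hs]; ring] at hG
  have hpi : 0 ≤ Real.log (2 * Real.pi) := Real.log_nonneg (by linarith [Real.pi_gt_three])
  have hl : Real.log ρ ≤ Real.log n + s / n := by
    have := Real.log_le_sub_one_of_pos (x := ρ / n) (by positivity)
    rw [Real.log_div (by positivity) (by positivity)] at this
    have e : ρ / n - 1 = s / n := by rw [hs]; field_simp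
    linarith
  have hm := mul_le_mul_of_nonneg_left hl (show 0 ≤ ρ + 1 / 2 by linarith)
  have e : (ρ + 1 / 2) * (s / n) ≤ s + 3 / 2 := by
    rw [← mul_div_assoc, div_le_iff₀ (by positivity)]
    have : ρ = n + s := by rw [hs]; ring
    rw [this]
    nlinarith
  nlinarith

theorem summable_mul_pow_div_factorial {b : ℕ → ℝ} (hb : ∀ m, |b m| ≤ 1) (s : ℝ) :
    Summable fun m : ℕ => b m * (s ^ m / m.factorial) := by
  refine Summable.of_norm_bounded (Real.summable_pow_div_factorial |s|) fun m => ?_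
  rw [Real.norm_eq_abs, abs_mul, abs_div, abs_pow, Nat.abs_cast]
  exact mul_le_of_le_one_left (by positivity) (hb m)

theorem hasDerivAt_tsum_mul_pow_div_factorial {b : ℕ → ℝ} (hb : ∀ m, |b m| ≤ 1) (s : ℝ) :
    HasDerivAt (fun s => ∑' m : ℕ, b m * (s ^ m / m.factorial))
      (∑' m : ℕ, b (m + 1) * (s ^ m / m.factorial)) s := by
  have hterm (m : ℕ) (y : ℝ) : HasDerivAt (fun y => b (m + 1) * (y ^ (m + 1) / (m + 1).factorial))
      (b (m + 1) * (y ^ m / m.factorial)) y := by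
    refine (((hasDerivAt_pow (m + 1) y).div_const _).const_mul _).congr_deriv ?_
    rw [Nat.factorial_succ]
    push_cast
    field_simp
  have hshift (y : ℝ) : ∑' m : ℕ, b m * (y ^ m / m.factorial) =
      b 0 + ∑' m : ℕ, b (m + 1) * (y ^ (m + 1) / (m + 1).factorial) := by
    rw [(summable_mul_pow_div_factorial hb y).tsum_eq_zero_add]
    simp
  simp_rw [hshift]
  refine HasDerivAt.const_add _ (hasDerivAt_tsum_of_isPreconnected
    (u := fun m : ℕ => (|s| + 1) ^ m / m.factorial) (t := Set.Ioo (-(|s| + 1)) (|s| + 1))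
    (y₀ := 0) (Real.summable_pow_div_factorial _) isOpen_Ioo isPreconnected_Ioo
    (fun m y _ => hterm m y) (fun m y hy => ?_) ?_ ?_ ?_)
  · rw [Real.norm_eq_abs, abs_mul, abs_div, abs_pow, Nat.abs_cast]
    refine (mul_le_of_le_one_left (by positivity) (hb _)).trans ?_
    have := (abs_lt.mpr hy).le
    gcongr
  · constructor <;> linarith [abs_nonneg s]
  · simp
  · exact abs_lt.mp (by linarith)

theorem monotoneOn_Icc_of_hasDerivAt {f f' : ℝ → ℝ} {a b : ℝ}
    (hf : ∀ x ∈ Set.Icc a b, HasDerivAt f (f' x) x) (h0 : ∀ x ∈ Set.Ioo a b, 0 ≤ f' x) :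
    MonotoneOn f (Set.Icc a b) := by
  refine monotoneOn_of_hasDerivWithinAt_nonneg (f' := f') (convex_Icc a b)
    (fun x hx => (hf x hx).continuousAt.continuousWithinAt) (fun x hx => ?_) (fun x hx => ?_)
  · exact (hf x (interior_subset hx)).hasDerivWithinAt
  · rw [interior_Icc] at hx
    exact h0 x hx

/-- A solution of `s Z'' + (ρ + 1) Z' + Z = 0` that is positive at `0` stays positive up to the
turning point `ρ ^ 2 / 4`. -/
theorem pos_of_bessel_ode {ρ T : ℝ} {Z Z₁ Z₂ : ℝ → ℝ} (hρ : 1 ≤ ρ) (hT : 4 * T ≤ ρ ^ 2)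
    (h1 : ∀ s, HasDerivAt Z (Z₁ s) s) (h2 : ∀ s, HasDerivAt Z₁ (Z₂ s) s)
    (hode : ∀ s, s * Z₂ s + (ρ + 1) * Z₁ s + Z s = 0) (h0 : 0 < Z 0) :
    ∀ s ∈ Set.Icc 0 T, 0 < Z s := by
  have hd (s : ℝ) : HasDerivAt (fun s => s ^ ρ) (ρ * s ^ (ρ - 1)) s :=
    Real.hasDerivAt_rpow_const (Or.inr hρ)
  have hpow {s : ℝ} (hs : 0 < s) : s ^ ρ = s ^ (ρ - 1) * s := by
    rw [Real.rpow_sub_one hs.ne']; field_simp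
  have hP : MonotoneOn (fun s => s ^ ρ * (Z s * (ρ * Z s + 2 * (s * Z₁ s)))) (Set.Icc 0 T) := by
    refine monotoneOn_Icc_of_hasDerivAt (fun s _ => (hd s).mul ((h1 s).mul
      (((h1 s).const_mul ρ).add (((hasDerivAt_id s).mul (h2 s)).const_mul 2)))) ?_
    intro s hs
    have e : s * Z₂ s = -(ρ + 1) * Z₁ s - Z s := by linarith [hode s]
    have := Real.rpow_nonneg hs.1.le (ρ - 1)
    have hq : 0 ≤ ρ ^ 2 - 4 * s := by linarith [hs.2]
    have key : 0 ≤ s ^ (ρ - 1) * ((ρ * Z s + 2 * (s * Z₁ s)) ^ 2 + (ρ ^ 2 - 4 * s) * Z s ^ 2) := by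
      positivity
    simp only [id]
    rw [hpow hs.1, e]
    linear_combination key / 2
  have hE : MonotoneOn (fun s => s ^ ρ * Z s ^ 2) (Set.Icc 0 T) := by
    refine monotoneOn_Icc_of_hasDerivAt (fun s _ => (hd s).mul ((h1 s).pow 2)) ?_
    intro s hs
    have := hP (Set.left_mem_Icc.mpr (hs.1.le.trans hs.2.le)) ⟨hs.1.le, hs.2.le⟩ hs.1.le
    simp only [Real.zero_rpow (by linarith : ρ ≠ 0), zero_mul, hpow hs.1] at this
    simp only [hpow hs.1]
    have h3 : 0 ≤ s ^ (ρ - 1) * (Z s * (ρ * Z s + 2 * (s * Z₁ s))) :=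
      nonneg_of_mul_nonneg_right (by linarith) hs.1
    norm_num
    linarith
  have hc : Continuous Z := continuous_iff_continuousAt.mpr fun s => (h1 s).continuousAt
  intro t ht
  by_contra! hneg
  obtain ⟨c, hc1, hc0⟩ := intermediate_value_Icc' ht.1 hc.continuousOn ⟨hneg, h0.le⟩
  have hcpos : 0 < c := lt_of_le_of_ne hc1.1 (by rintro rfl; linarith)
  have hev : ∀ᶠ s in nhdsWithin (0 : ℝ) (Set.Ioi 0), 0 < Z s :=
    (hc.continuousAt.eventually (lt_mem_nhds h0)).filter_mono nhdsWithin_le_nhds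
  obtain ⟨s, hs, hsc⟩ := (hev.and (Ioo_mem_nhdsGT hcpos)).exists
  have := hE ⟨hsc.1.le, hsc.2.le.trans (hc1.2.trans ht.2)⟩ ⟨hc1.1, hc1.2.trans ht.2⟩ hsc.2.le
  simp only [hc0] at this
  have : 0 < s ^ ρ * Z s ^ 2 := mul_pos (Real.rpow_pos_of_pos hsc.1 _) (by positivity)
  norm_num at *
  linarith

/-- Comparison with the Liouville–Green approximation of the recessive solution. -/
theorem le_liouville_green_of_bessel_ode {ρ T : ℝ} {Z Z₁ Z₂ : ℝ → ℝ} (hρ : 1 ≤ ρ)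
    (hT0 : 0 ≤ T) (hT : 4 * T < ρ ^ 2)
    (h1 : ∀ s, HasDerivAt Z (Z₁ s) s) (h2 : ∀ s, HasDerivAt Z₁ (Z₂ s) s)
    (hode : ∀ s, s * Z₂ s + (ρ + 1) * Z₁ s + Z s = 0) (h0 : 0 < Z 0) :
    Real.log (Z T) ≤ Real.log (Z 0) - ρ + ρ * Real.log (2 * ρ) + Real.log ρ / 2 +
      √(ρ ^ 2 - 4 * T) - ρ * Real.log (ρ + √(ρ ^ 2 - 4 * T)) - Real.log (ρ ^ 2 - 4 * T) / 4 := by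
  have hZ := pos_of_bessel_ode hρ hT.le h1 h2 hode h0
  let q : ℝ → ℝ := fun s => ρ ^ 2 - 4 * s
  let κ : ℝ → ℝ := fun s => 1 / q s - 2 / (ρ + √(q s))
  let φ : ℝ → ℝ := fun s => √(q s) - ρ * Real.log (ρ + √(q s)) - Real.log (q s) / 4
  have hq {s} (hs : s ∈ Set.Icc 0 T) : 0 < q s := by simp only [q]; linarith [hs.2]
  have hdq (s : ℝ) : HasDerivAt q (-4) s := by
    simpa using ((hasDerivAt_id s).const_mul 4).const_sub (ρ ^ 2)
  have hdr {s} (hs : s ∈ Set.Icc 0 T) : HasDerivAt (fun s => √(q s)) (-2 / √(q s)) s := by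
    convert (hdq s).sqrt (hq hs).ne' using 1
    field_simp; norm_num
  have hr {s} (hs : s ∈ Set.Icc 0 T) : 0 < √(q s) := Real.sqrt_pos.mpr (hq hs)
  have hφ {s} (hs : s ∈ Set.Icc 0 T) : HasDerivAt φ (κ s) s := by
    have hr' := hr hs
    have hq' := hq hs
    have hpos : 0 < ρ + √(q s) := by positivity
    refine (((hdr hs).sub ((((hdr hs).const_add ρ).log hpos.ne').const_mul ρ)).sub
      (((hdq s).log (hq hs).ne').div_const 4)).congr_deriv ?_
    simp only [κ]
    field_simp
    ring
  have hκ {s} (hs : s ∈ Set.Icc 0 T) :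
      HasDerivAt κ (4 / q s ^ 2 - 4 / (√(q s) * (ρ + √(q s)) ^ 2)) s := by
    have hr' := hr hs
    have hq' := hq hs
    have hpos : 0 < ρ + √(q s) := by positivity
    refine (((hasDerivAt_const s (1 : ℝ)).div (hdq s) (hq hs).ne').sub
      ((hasDerivAt_const s (2 : ℝ)).div ((hdr hs).const_add ρ) hpos.ne')).congr_deriv ?_
    field_simp
    ring
  have hid {s} (hs : s ∈ Set.Icc 0 T) :
      1 + (ρ + 1) * κ s + s * ((4 / q s ^ 2 - 4 / (√(q s) * (ρ + √(q s)) ^ 2)) + κ s ^ 2) =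
        (5 * s + q s) / q s ^ 2 := by
    have hr' := hr hs
    have hsq : q s = √(q s) ^ 2 := (Real.sq_sqrt (hq hs).le).symm
    have hs' : s = (ρ ^ 2 - √(q s) ^ 2) / 4 := by rw [← hsq]; simp only [q]; ring
    simp only [κ]
    generalize √(q s) = r at *
    rw [hsq, hs']
    have hpos : 0 < ρ + r := by positivity
    field_simp
    ring
  have hd (s : ℝ) : HasDerivAt (fun s => s ^ (ρ + 1)) ((ρ + 1) * s ^ ρ) s := by
    simpa using Real.hasDerivAt_rpow_const (x := s) (p := ρ + 1) (Or.inr (by linarith))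
  have hD : MonotoneOn (fun s => s ^ (ρ + 1) * ((κ s * Z s - Z₁ s) * Real.exp (φ s)))
      (Set.Icc 0 T) := by
    refine monotoneOn_Icc_of_hasDerivAt (fun s hs => (hd s).mul
      ((((hκ hs).mul (h1 s)).sub (h2 s)).mul (hφ hs).exp)) ?_
    intro s hs
    have hs' := Set.Ioo_subset_Icc_self hs
    have hpow : s ^ (ρ + 1) = s ^ ρ * s := Real.rpow_add_one hs.1.ne' _
    have := Real.rpow_nonneg hs.1.le ρ
    have hZs := hZ s hs'
    have hqs := hq hs'
    have hs0 := hs.1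
    have key : 0 ≤ s ^ ρ * Real.exp (φ s) * Z s * ((5 * s + q s) / q s ^ 2) := by positivity
    rw [← hid hs'] at key
    simp only [Pi.mul_apply, Pi.sub_apply, hpow]
    linear_combination key + s ^ ρ * Real.exp (φ s) * hode s
  have hκZ {s} (hs : s ∈ Set.Ioo 0 T) : 0 ≤ κ s * Z s - Z₁ s := by
    have := hD (Set.left_mem_Icc.mpr hT0) ⟨hs.1.le, hs.2.le⟩ hs.1.le
    simp only [Real.zero_rpow (by linarith : ρ + 1 ≠ 0), zero_mul] at this
    have h3 := nonneg_of_mul_nonneg_right this (Real.rpow_pos_of_pos hs.1 _)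
    exact nonneg_of_mul_nonneg_left h3 (Real.exp_pos _)
  have hm : MonotoneOn (fun s => φ s - Real.log (Z s)) (Set.Icc 0 T) := by
    refine monotoneOn_Icc_of_hasDerivAt
      (fun s hs => (hφ hs).sub ((h1 s).log (hZ s hs).ne')) ?_
    intro s hs
    have hZs := hZ s (Set.Ioo_subset_Icc_self hs)
    rw [sub_nonneg, div_le_iff₀ hZs]
    linarith [hκZ hs]
  have := hm (Set.left_mem_Icc.mpr hT0) (Set.right_mem_Icc.mpr hT0) hT0
  have e0 : √(ρ ^ 2) = ρ := Real.sqrt_sq (by linarith)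
  simp only [φ, q, mul_zero, sub_zero, e0, Real.log_pow, ← two_mul] at this
  push_cast at this
  linarith

/-- The entire function `s ↦ ∑ (-s)^m / (m! Γ(m+ρ+1))`. -/
noncomputable def besselEntire (ρ s : ℝ) : ℝ :=
  ∑' m : ℕ, ((-1) ^ m / Real.Gamma (m + ρ + 1)) * (s ^ m / m.factorial)

theorem abs_besselEntire_coeff_le {ρ : ℝ} (hρ : 1 ≤ ρ) (m : ℕ) :
    |(-1) ^ m / Real.Gamma (m + ρ + 1)| ≤ 1 := by
  have hm : (0 : ℝ) ≤ m := m.cast_nonneg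
  have h : 1 ≤ Real.Gamma (m + ρ + 1) := by
    have h2 : Real.Gamma 2 ≤ Real.Gamma (m + ρ + 1) := Real.Gamma_strictMonoOn_Ici.monotoneOn (by simp)
      (by simp only [Set.mem_Ici]; linarith) (by linarith)
    rwa [Real.Gamma_two] at h2
  rw [abs_div, abs_pow, abs_neg, abs_one, one_pow, abs_of_pos (by linarith)]
  exact div_le_one_of_le₀ h (by linarith)

theorem hasDerivAt_besselEntire {ρ : ℝ} (hρ : 1 ≤ ρ) (s : ℝ) :
    HasDerivAt (besselEntire ρ) (-besselEntire (ρ + 1) s) s := by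
  refine (hasDerivAt_tsum_mul_pow_div_factorial
    (abs_besselEntire_coeff_le hρ) s).congr_deriv ?_
  rw [besselEntire, ← tsum_neg]
  refine tsum_congr fun m => ?_
  rw [show ((m + 1 : ℕ) : ℝ) + ρ + 1 = m + (ρ + 1) + 1 by push_cast; ring]
  ring

theorem besselEntire_recurrence {ρ : ℝ} (hρ : 1 ≤ ρ) (s : ℝ) :
    besselEntire ρ s - (ρ + 1) * besselEntire (ρ + 1) s + s * besselEntire (ρ + 2) s = 0 := by
  have S0 := summable_mul_pow_div_factorial (abs_besselEntire_coeff_le hρ) s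
  have S1 := summable_mul_pow_div_factorial
    (abs_besselEntire_coeff_le (show 1 ≤ ρ + 1 by linarith)) s
  have key : besselEntire ρ s - (ρ + 1) * besselEntire (ρ + 1) s =
      ∑' m : ℕ, m * ((-1) ^ m / Real.Gamma (m + (ρ + 1) + 1) * (s ^ m / m.factorial)) := by
    rw [besselEntire, besselEntire, ← tsum_mul_left, ← S0.tsum_sub (S1.mul_left _)]
    refine tsum_congr fun m => ?_
    have hpos : (0 : ℝ) < m + ρ + 1 := by positivity
    have hG := Real.Gamma_pos_of_pos hpos
    rw [show (m : ℝ) + (ρ + 1) + 1 = (m + ρ + 1) + 1 by ring, Real.Gamma_add_one hpos.ne']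
    field_simp
    ring
  have S2 : Summable fun m : ℕ =>
      (m : ℝ) * ((-1) ^ m / Real.Gamma (m + (ρ + 1) + 1) * (s ^ m / m.factorial)) := by
    refine (S0.sub (S1.mul_left (ρ + 1))).congr fun m => ?_
    have hpos : (0 : ℝ) < m + ρ + 1 := by positivity
    have hG := Real.Gamma_pos_of_pos hpos
    rw [show (m : ℝ) + (ρ + 1) + 1 = (m + ρ + 1) + 1 by ring, Real.Gamma_add_one hpos.ne']
    field_simp
    ring
  rw [key, S2.tsum_eq_zero_add, besselEntire, ← tsum_mul_left]
  simp only [CharP.cast_eq_zero, zero_mul, zero_add]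
  rw [← Summable.tsum_add]
  · convert tsum_zero with m
    rw [show ((m + 1 : ℕ) : ℝ) + (ρ + 1) + 1 = m + (ρ + 2) + 1 by push_cast; ring,
      Nat.factorial_succ]
    push_cast
    field_simp
    ring
  · exact (summable_nat_add_iff 1).mpr S2
  · exact (summable_mul_pow_div_factorial
      (abs_besselEntire_coeff_le (show 1 ≤ ρ + 2 by linarith)) s).mul_left s

theorem besselJ_eq_rpow_mul_besselEntire {x : ℝ} (hx : 0 < x) (ρ : ℝ) :
    besselJ ρ x = (x / 2) ^ ρ * besselEntire ρ (x ^ 2 / 4) := by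
  rw [besselJ, besselEntire, ← tsum_mul_left]
  refine tsum_congr fun m => ?_
  rw [Real.rpow_add (by positivity), Real.rpow_mul (by positivity), Real.Gamma_nat_eq_factorial,
    Real.rpow_natCast, Real.rpow_two, show (x / 2) ^ 2 = x ^ 2 / 4 by ring]
  rw [mul_comm ((m.factorial : ℝ)), ← div_div]
  ring

theorem add_le_log_of_sq_add_sq_eq {ρ x r : ℝ} (hρ : 0 < ρ) (hx : 0 < x) (hr : 0 ≤ r)
    (h : x ^ 2 + r ^ 2 = ρ ^ 2) : r / ρ + Real.log x ≤ Real.log (ρ + r) := by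
  have hrρ : r < ρ := by nlinarith
  have ha0 : 0 ≤ r / ρ := by positivity
  have ha1 : r / ρ < 1 := (div_lt_one hρ).mpr hrρ
  have hs := Real.hasSum_log_sub_log_of_abs_lt_one (x := r / ρ) (by rwa [abs_of_nonneg ha0])
  have h1 := le_hasSum hs 0 fun k _ => by positivity
  rw [show 1 + r / ρ = (ρ + r) / ρ by field_simp, show 1 - r / ρ = (ρ - r) / ρ by field_simp,
    Real.log_div (by positivity) hρ.ne', Real.log_div (by linarith) hρ.ne'] at h1
  have h2 : 2 * Real.log x = Real.log (ρ + r) + Real.log (ρ - r) := by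
    rw [← Real.log_mul (by positivity) (by linarith), show (ρ + r) * (ρ - r) = x ^ 2 by linarith,
      Real.log_pow]
    norm_num
  norm_num at h1
  linarith

theorem besselEntire_zero (ρ : ℝ) : besselEntire ρ 0 = 1 / Real.Gamma (ρ + 1) := by
  rw [besselEntire, tsum_eq_single 0 fun m hm => by simp [hm]]
  simp

/-- Below the turning point, `|J_ρ(x)| ≤ e^{3/2} (ρ² - x²)^{-1/4}`. -/
theorem abs_besselJ_le {ρ x : ℝ} (hρ : 1 < ρ) (hx : 0 < x) (hxρ : x < ρ) :
    |besselJ ρ x| ≤ Real.exp (3 / 2) * (ρ ^ 2 - x ^ 2) ^ (-(1 : ℝ) / 4) := by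
  have hT : 4 * (x ^ 2 / 4) < ρ ^ 2 := by nlinarith
  have hq : 0 < ρ ^ 2 - x ^ 2 := by linarith
  have h1 := hasDerivAt_besselEntire hρ.le
  have h2 (s : ℝ) : HasDerivAt (fun s => -besselEntire (ρ + 1) s) (besselEntire (ρ + 2) s) s := by
    have := (hasDerivAt_besselEntire (show 1 ≤ ρ + 1 by linarith) s).neg
    rw [neg_neg, show ρ + 1 + 1 = ρ + 2 by ring] at this
    exact this
  have hode (s : ℝ) : s * besselEntire (ρ + 2) s + (ρ + 1) * -besselEntire (ρ + 1) s +
      besselEntire ρ s = 0 := by linarith [besselEntire_recurrence hρ.le s]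
  have hG : 0 < Real.Gamma (ρ + 1) := Real.Gamma_pos_of_pos (by linarith)
  have h0 : 0 < besselEntire ρ 0 := by
    rw [besselEntire_zero]
    positivity
  have hpos : 0 < besselEntire ρ (x ^ 2 / 4) :=
    pos_of_bessel_ode hρ.le hT.le h1 h2 hode h0 _ ⟨by positivity, le_rfl⟩
  have hlog := le_liouville_green_of_bessel_ode hρ.le (by positivity) hT h1 h2 hode h0
  rw [besselEntire_zero, one_div, Real.log_inv,
    show 4 * (x ^ 2 / 4) = x ^ 2 by ring] at hlog
  have hS := le_log_Gamma_stirling hρ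
  have hA := add_le_log_of_sq_add_sq_eq (r := √(ρ ^ 2 - x ^ 2)) (by linarith : 0 < ρ) hx
    (Real.sqrt_nonneg _) (by rw [Real.sq_sqrt hq.le]; ring)
  have hA' := mul_le_mul_of_nonneg_left hA (by linarith : 0 ≤ ρ)
  rw [mul_add, mul_div_cancel₀ _ (by linarith : ρ ≠ 0)] at hA'
  rw [besselJ_eq_rpow_mul_besselEntire hx, abs_of_pos (by positivity)]
  rw [← Real.log_le_log_iff (by positivity) (by positivity),
    Real.log_mul (by positivity) hpos.ne', Real.log_mul (by positivity) (by positivity),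
    Real.log_exp, Real.log_rpow (by positivity), Real.log_rpow hq,
    Real.log_div hx.ne' (by norm_num)]
  rw [Real.log_mul (by norm_num) (by linarith)] at hlog
  linarith

/-- For every `C > 0` there exist `K > 0`, `ρ₀ > 0` (depending only
on `C`) such that for all real `ρ ≥ ρ₀` and `x` with
`ρ - C ρ^{1/3} (log ρ)^{1/3} ≤ x ≤ ρ - C ρ^{1/3}`, one has `|J_ρ(x)| ≤ K ρ^{-1/3}`. -/
theorem besselJ_transition_gap_bound (C : ℝ) (hC : 0 < C) :
    ∃ K ρ₀ : ℝ, 0 < K ∧ 0 < ρ₀ ∧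
      ∀ ρ x : ℝ, ρ₀ ≤ ρ →
        ρ - C * ρ ^ ((1 : ℝ) / 3) * Real.log ρ ^ ((1 : ℝ) / 3) ≤ x →
        x ≤ ρ - C * ρ ^ ((1 : ℝ) / 3) →
        |besselJ ρ x| ≤ K * ρ ^ (-(1 : ℝ) / 3) := by
  refine ⟨Real.exp (3 / 2) * C ^ (-(1 : ℝ) / 4), max 2 ((C + 1) ^ 3), by positivity, by positivity,
    fun ρ x hρ hlow hup => ?_⟩
  have hρ2 : 2 ≤ ρ := (le_max_left _ _).trans hρ
  have hρC : (C + 1) ^ 3 ≤ ρ := (le_max_right _ _).trans hρ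
  have hρ0 : 0 < ρ := by linarith
  have hlog0 : 0 ≤ Real.log ρ := Real.log_nonneg (by linarith)
  have hx : 0 < x := by
    refine lt_of_lt_of_le ?_ hlow
    have hl : Real.log ρ ^ ((1 : ℝ) / 3) ≤ ρ ^ ((1 : ℝ) / 3) :=
      Real.rpow_le_rpow hlog0 (Real.log_le_self hρ0.le) (by norm_num)
    have hCr : C < ρ ^ ((1 : ℝ) / 3) := by
      have : ((C + 1) ^ 3) ^ ((1 : ℝ) / 3) ≤ ρ ^ ((1 : ℝ) / 3) :=
        Real.rpow_le_rpow (by positivity) hρC (by norm_num)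
      rw [← Real.rpow_natCast, ← Real.rpow_mul (by positivity)] at this
      norm_num at this ⊢
      linarith
    have hcube : ρ ^ ((1 : ℝ) / 3) * ρ ^ ((1 : ℝ) / 3) * ρ ^ ((1 : ℝ) / 3) = ρ := by
      rw [← Real.rpow_add hρ0, ← Real.rpow_add hρ0]
      norm_num
    have hr0 : 0 < ρ ^ ((1 : ℝ) / 3) := by positivity
    have e1 := mul_le_mul_of_nonneg_left hl (by positivity : 0 ≤ C * ρ ^ ((1 : ℝ) / 3))
    have e2 := mul_lt_mul_of_pos_right hCr (mul_pos hr0 hr0)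
    linarith
  have hCρ : 0 < C * ρ ^ ((1 : ℝ) / 3) := by positivity
  have hq : C * ρ ^ ((4 : ℝ) / 3) ≤ ρ ^ 2 - x ^ 2 := by
    rw [show (4 : ℝ) / 3 = 1 / 3 + 1 by norm_num, Real.rpow_add_one hρ0.ne']
    nlinarith
  calc |besselJ ρ x| ≤ Real.exp (3 / 2) * (ρ ^ 2 - x ^ 2) ^ (-(1 : ℝ) / 4) :=
        abs_besselJ_le (by linarith) hx (by linarith)
    _ ≤ Real.exp (3 / 2) * (C * ρ ^ ((4 : ℝ) / 3)) ^ (-(1 : ℝ) / 4) := by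
        gcongr ?_ * ?_
        exact Real.rpow_le_rpow_of_nonpos (by positivity) hq (by norm_num)
    _ = Real.exp (3 / 2) * C ^ (-(1 : ℝ) / 4) * ρ ^ (-(1 : ℝ) / 3) := by
        rw [Real.mul_rpow hC.le (by positivity), ← Real.rpow_mul hρ0.le, mul_assoc]
        norm_num
end

section
/- For every real constant C > 0 there exist constants K > 0 and ρ₀ > 0 (depending only on C) such that for every real ρ ≥ ρ₀ and every real x > 0 with |x - ρ| ≤ C ρ^{1/3}, one has |J_ρ(x)| ≤ K · ρ^{-1/3}. -/
open Filter Topology Set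

/-- The coefficients of the entire function `besselCore ρ`. -/
noncomputable def besselCoeff (ρ : ℝ) (m : ℕ) : ℝ :=
  (-1) ^ m / (m.factorial * Real.Gamma (m + ρ + 1))

/-- The entire part of the Bessel function: `J_ρ(x) = (x/2)^ρ * besselCore ρ (x²/4)`. -/
noncomputable def besselCore (ρ z : ℝ) : ℝ := ∑' m : ℕ, besselCoeff ρ m * z ^ m

lemma Gamma_le_Gamma_nat_add {ρ : ℝ} (hρ : 0 < ρ) (m : ℕ) :
    Real.Gamma (ρ + 1) ≤ Real.Gamma (m + ρ + 1) := by
  induction m with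
  | zero => simp
  | succ k ih =>
    have h : ((k + 1 : ℕ) : ℝ) + ρ + 1 = (k + ρ + 1) + 1 := by push_cast; ring
    have hk : (0 : ℝ) ≤ k := k.cast_nonneg
    rw [h, Real.Gamma_add_one (s := k + ρ + 1) (by positivity)]
    have : 0 < Real.Gamma (k + ρ + 1) := Real.Gamma_pos_of_pos (by positivity)
    exact ih.trans (le_mul_of_one_le_left this.le (by linarith))

lemma abs_besselCoeff_le {ρ : ℝ} (hρ : 0 < ρ) (m : ℕ) :
    |besselCoeff ρ m| ≤ (Real.Gamma (ρ + 1))⁻¹ * (m.factorial : ℝ)⁻¹ := by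
  have h0 : 0 < Real.Gamma (ρ + 1) := Real.Gamma_pos_of_pos (by positivity)
  have h1 := Gamma_le_Gamma_nat_add hρ m
  have hm : (0 : ℝ) < m.factorial := by exact_mod_cast m.factorial_pos
  rw [besselCoeff, abs_div, abs_pow, abs_neg, abs_one, one_pow,
    abs_of_pos (mul_pos hm (h0.trans_le h1)), one_div, mul_inv, mul_comm]
  gcongr

lemma summable_besselCoeff_mul_pow {ρ : ℝ} (hρ : 0 < ρ) (z : ℝ) :
    Summable fun m : ℕ => besselCoeff ρ m * z ^ m := by
  refine Summable.of_norm_bounded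
    ((Real.summable_pow_div_factorial |z|).mul_left (Real.Gamma (ρ + 1))⁻¹) fun m => ?_
  rw [Real.norm_eq_abs, abs_mul, abs_pow, div_eq_mul_inv, mul_comm (|z| ^ m), ← mul_assoc]
  gcongr
  exact abs_besselCoeff_le hρ m

lemma succ_mul_besselCoeff_succ (ρ : ℝ) (m : ℕ) :
    ((m : ℝ) + 1) * besselCoeff ρ (m + 1) = -besselCoeff (ρ + 1) m := by
  have hm : (0 : ℝ) < m.factorial := by exact_mod_cast m.factorial_pos
  have h : ((m + 1 : ℕ) : ℝ) + ρ + 1 = m + (ρ + 1) + 1 := by push_cast; ring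
  have hm' : (m : ℝ) + 1 ≠ 0 := by positivity
  simp only [besselCoeff, h, Nat.factorial_succ, pow_succ]
  push_cast
  rw [mul_assoc, mul_div_assoc', mul_div_mul_left _ _ hm']
  ring

lemma hasDerivAt_besselCore {ρ : ℝ} (hρ : 0 < ρ) (z : ℝ) :
    HasDerivAt (besselCore ρ) (-besselCore (ρ + 1) z) z := by
  have hz : z ∈ Metric.ball (0 : ℝ) (|z| + 1) := by simp
  have key : HasDerivAt (besselCore ρ)
      (∑' m : ℕ, besselCoeff ρ m * (m * z ^ (m - 1))) z := by
    refine hasDerivAt_tsum_of_isPreconnected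
      (u := fun m : ℕ => (Real.Gamma (ρ + 1))⁻¹ * (m.factorial : ℝ)⁻¹ *
        (m * (|z| + 1) ^ (m - 1)))
      ?_ Metric.isOpen_ball (convex_ball _ _).isPreconnected
      (fun m w _ => (hasDerivAt_pow m w).const_mul _) (fun m w hw => ?_) hz
      (summable_besselCoeff_mul_pow hρ z) hz
    · rw [← summable_nat_add_iff 1]
      refine (summable_congr fun m => ?_).2
        ((Real.summable_pow_div_factorial (|z| + 1)).mul_left (Real.Gamma (ρ + 1))⁻¹)
      have hm : (0 : ℝ) < m.factorial := by exact_mod_cast m.factorial_pos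
      rw [Nat.factorial_succ, Nat.add_sub_cancel]
      push_cast
      field_simp
    · have hw' : |w| ≤ |z| + 1 := by simpa using (Metric.mem_ball.1 hw).le
      rw [Real.norm_eq_abs, abs_mul, abs_mul, abs_pow, Nat.abs_cast]
      gcongr
      exact abs_besselCoeff_le hρ m
  convert key using 1
  rw [tsum_eq_zero_add']
  · simp only [besselCore, ← tsum_neg, Nat.cast_zero, zero_mul, mul_zero, zero_add,
      Nat.add_sub_cancel]
    refine tsum_congr fun m => ?_
    rw [← neg_mul, ← succ_mul_besselCoeff_succ]
    push_cast
    ring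
  · refine (summable_congr fun m => ?_).2
      (summable_besselCoeff_mul_pow (ρ := ρ + 1) (by positivity) z).neg
    rw [← neg_mul, ← succ_mul_besselCoeff_succ, Nat.add_sub_cancel]
    push_cast
    ring

lemma besselCoeff_eq {ρ : ℝ} (hρ : 0 < ρ) (m : ℕ) :
    besselCoeff ρ m = (m + ρ + 1) * besselCoeff (ρ + 1) m := by
  have h0 : (m : ℝ) + ρ + 1 ≠ 0 := by positivity
  have hG : Real.Gamma (m + ρ + 1) ≠ 0 := (Real.Gamma_pos_of_pos (by positivity)).ne'
  have hm : (m.factorial : ℝ) ≠ 0 := by exact_mod_cast m.factorial_ne_zero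
  rw [besselCoeff, besselCoeff, show (m : ℝ) + (ρ + 1) + 1 = (m + ρ + 1) + 1 by ring,
    Real.Gamma_add_one h0]
  field_simp

lemma besselCore_recurrence {ρ : ℝ} (hρ : 0 < ρ) (z : ℝ) :
    besselCore ρ z = (ρ + 1) * besselCore (ρ + 1) z - z * besselCore (ρ + 2) z := by
  have h1 := summable_besselCoeff_mul_pow (ρ := ρ + 1) (by positivity) z
  have h2 := summable_besselCoeff_mul_pow (ρ := ρ + 2) (by positivity) z
  have e : ∀ m : ℕ, (((m + 1 : ℕ) : ℝ) * besselCoeff (ρ + 1) (m + 1)) * z ^ (m + 1)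
      = -(z * (besselCoeff (ρ + 2) m * z ^ m)) := fun m => by
    push_cast
    rw [succ_mul_besselCoeff_succ, show ρ + 1 + 1 = ρ + 2 by ring]
    ring
  have s3 : Summable fun m : ℕ =>
      (((m + 1 : ℕ) : ℝ) * besselCoeff (ρ + 1) (m + 1)) * z ^ (m + 1) := by
    simp only [e]
    exact (h2.mul_left z).neg
  have s4 : Summable fun m : ℕ => ((m : ℝ) * besselCoeff (ρ + 1) m) * z ^ m :=
    (summable_nat_add_iff (f := fun m : ℕ => ((m : ℝ) * besselCoeff (ρ + 1) m) * z ^ m) 1).1 s3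
  have e3 : ∑' m : ℕ, ((m : ℝ) * besselCoeff (ρ + 1) m) * z ^ m
      = -(z * besselCore (ρ + 2) z) := by
    rw [tsum_eq_zero_add' (f := fun m : ℕ => ((m : ℝ) * besselCoeff (ρ + 1) m) * z ^ m) s3,
      tsum_congr e, tsum_neg, tsum_mul_left]
    simp [besselCore]
  rw [sub_eq_add_neg, ← e3, besselCore, besselCore, ← tsum_mul_left,
    ← (h1.mul_left (ρ + 1)).tsum_add s4]
  refine tsum_congr fun m => ?_
  rw [besselCoeff_eq hρ]
  ring

lemma besselCore_zero (ρ : ℝ) : besselCore ρ 0 = (Real.Gamma (ρ + 1))⁻¹ := by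
  rw [besselCore, tsum_eq_single 0 (fun m hm => by simp [hm])]
  simp [besselCoeff]

lemma besselJ_mul_exp {ρ : ℝ} (hρ : 0 < ρ) (t : ℝ) :
    besselJ ρ (ρ * Real.exp t) =
      Real.exp (ρ * (t + Real.log (ρ / 2))) * besselCore ρ (ρ ^ 2 * Real.exp (2 * t) / 4) := by
  have hx : ρ * Real.exp t / 2 = Real.exp (t + Real.log (ρ / 2)) := by
    rw [Real.exp_add, Real.exp_log (by positivity)]; ring
  have hz : ρ ^ 2 * Real.exp (2 * t) / 4 = (Real.exp (t + Real.log (ρ / 2))) ^ 2 := by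
    rw [← hx, two_mul, Real.exp_add]; ring
  rw [besselJ, besselCore, ← tsum_mul_left, hx, hz]
  refine tsum_congr fun m => ?_
  rw [← Real.exp_mul, Real.Gamma_nat_eq_factorial, besselCoeff, ← pow_mul, ← Real.exp_nat_mul,
    mul_add (t + Real.log (ρ / 2)), Real.exp_add]
  push_cast
  rw [mul_comm (t + _) ρ, mul_comm (t + _) (2 * (m : ℝ))]
  ring

/-- The derivative of `t ↦ J_ρ(ρ eᵗ)`. -/
noncomputable def besselJExpDeriv (ρ t : ℝ) : ℝ :=
  Real.exp (ρ * (t + Real.log (ρ / 2))) *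
    (ρ * besselCore ρ (ρ ^ 2 * Real.exp (2 * t) / 4) -
      2 * (ρ ^ 2 * Real.exp (2 * t) / 4) *
        besselCore (ρ + 1) (ρ ^ 2 * Real.exp (2 * t) / 4))

lemma hasDerivAt_exp_two_mul (t : ℝ) :
    HasDerivAt (fun t => Real.exp (2 * t)) (2 * Real.exp (2 * t)) t := by
  simpa [mul_comm] using ((hasDerivAt_id t).const_mul (2 : ℝ)).exp

lemma hasDerivAt_exp_mul_add (ρ a t : ℝ) :
    HasDerivAt (fun t => Real.exp (ρ * (t + a))) (ρ * Real.exp (ρ * (t + a))) t := by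
  simpa [mul_comm] using (((hasDerivAt_id t).add_const a).const_mul ρ).exp

lemma hasDerivAt_besselCore_exp {ρ : ℝ} (hρ : 0 < ρ) (c t : ℝ) :
    HasDerivAt (fun t => besselCore ρ (c * Real.exp (2 * t) / 4))
      (-besselCore (ρ + 1) (c * Real.exp (2 * t) / 4) * (2 * (c * Real.exp (2 * t) / 4))) t := by
  have h := ((hasDerivAt_exp_two_mul t).const_mul c).div_const 4
  refine ((hasDerivAt_besselCore hρ _).comp t h).congr_deriv ?_
  ring

lemma hasDerivAt_besselJ_exp {ρ : ℝ} (hρ : 0 < ρ) (t : ℝ) :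
    HasDerivAt (fun t => besselJ ρ (ρ * Real.exp t)) (besselJExpDeriv ρ t) t := by
  simp only [besselJ_mul_exp hρ]
  refine ((hasDerivAt_exp_mul_add ρ (Real.log (ρ / 2)) t).mul
    (hasDerivAt_besselCore_exp hρ (ρ ^ 2) t)).congr_deriv ?_
  rw [besselJExpDeriv]
  ring

lemma hasDerivAt_besselJExpDeriv {ρ : ℝ} (hρ : 0 < ρ) (t : ℝ) :
    HasDerivAt (besselJExpDeriv ρ)
      (ρ ^ 2 * (1 - Real.exp (2 * t)) * besselJ ρ (ρ * Real.exp t)) t := by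
  have hz := (((hasDerivAt_exp_two_mul t).const_mul (ρ ^ 2)).div_const 4).const_mul 2
  have h := (hasDerivAt_exp_mul_add ρ (Real.log (ρ / 2)) t).mul
    (((hasDerivAt_besselCore_exp hρ (ρ ^ 2) t).const_mul ρ).sub
      (hz.mul (hasDerivAt_besselCore_exp (ρ := ρ + 1) (by positivity) (ρ ^ 2) t)))
  refine h.congr_deriv ?_
  simp only [Pi.sub_apply, Pi.mul_apply]
  have r := besselCore_recurrence hρ (ρ ^ 2 * Real.exp (2 * t) / 4)
  rw [show ρ + 1 + 1 = ρ + 2 by ring, besselJ_mul_exp hρ]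
  set z := ρ ^ 2 * Real.exp (2 * t) / 4 with hzdef
  have hez : ρ ^ 2 * Real.exp (2 * t) = 4 * z := by rw [hzdef]; ring
  rw [show ρ ^ 2 * (1 - Real.exp (2 * t)) = ρ ^ 2 - 4 * z by rw [← hez]; ring,
    show ρ ^ 2 * (2 * Real.exp (2 * t)) = 8 * z by linarith]
  linear_combination (4 * z * Real.exp (ρ * (t + Real.log (ρ / 2)))) * r

lemma sqrt_mul_exp_le_Gamma {ρ : ℝ} (hρ : 0 < ρ) :
    √ρ * Real.exp (ρ * Real.log ρ - ρ - 1 / 2) ≤ Real.Gamma (ρ + 1) := by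
  have hs : 0 < √ρ := Real.sqrt_pos.2 hρ
  have hss : √ρ * √ρ = ρ := Real.mul_self_sqrt hρ.le
  have hint := Real.GammaIntegral_convergent (s := ρ + 1) (by positivity)
  have hsub : Ioc ρ (ρ + √ρ) ⊆ Ioi 0 := fun x hx => hρ.trans hx.1
  rw [Real.Gamma_eq_integral (by positivity)]
  have hpt : ∀ x ∈ Ioc ρ (ρ + √ρ),
      Real.exp (ρ * Real.log ρ - ρ - 1 / 2) ≤ Real.exp (-x) * x ^ (ρ + 1 - 1) := by
    intro x hx
    have hx0 : 0 < x := hρ.trans hx.1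
    obtain ⟨h, rfl⟩ : ∃ h, x = ρ * (1 + h) := ⟨x / ρ - 1, by field_simp; ring⟩
    have hh : 0 ≤ h := by nlinarith [hx.1]
    have hh2 : √ρ * h ≤ 1 := by nlinarith [hx.2]
    have hρh : ρ * h ^ 2 ≤ 1 := by
      have : (√ρ * h) ^ 2 ≤ 1 := pow_le_one₀ (by positivity) hh2
      nlinarith
    have hlog : h - h ^ 2 / 2 ≤ Real.log (1 + h) := by
      refine le_trans ?_ (Real.le_log_one_add_of_nonneg hh)
      rw [le_div_iff₀ (by positivity)]
      nlinarith [pow_nonneg hh 3]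
    rw [add_sub_cancel_right, Real.rpow_def_of_pos hx0, ← Real.exp_add, Real.exp_le_exp,
      Real.log_mul hρ.ne' (by positivity)]
    nlinarith [mul_le_mul_of_nonneg_left hlog hρ.le]
  calc √ρ * Real.exp (ρ * Real.log ρ - ρ - 1 / 2)
      = ∫ _ in Ioc ρ (ρ + √ρ), Real.exp (ρ * Real.log ρ - ρ - 1 / 2) := by
        rw [MeasureTheory.setIntegral_const]
        simp [hs.le]
    _ ≤ ∫ x in Ioc ρ (ρ + √ρ), Real.exp (-x) * x ^ (ρ + 1 - 1) :=
        MeasureTheory.setIntegral_mono_on (by simp) (hint.mono_set hsub) measurableSet_Ioc hpt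
    _ ≤ ∫ x in Ioi 0, Real.exp (-x) * x ^ (ρ + 1 - 1) := by
        refine MeasureTheory.setIntegral_mono_set hint ?_ hsub.eventuallyLE
        filter_upwards [MeasureTheory.ae_restrict_mem measurableSet_Ioi] with x hx
        have : (0 : ℝ) < x := hx
        simp only [Pi.zero_apply]
        positivity

lemma tendsto_exp_two_mul_atBot :
    Tendsto (fun t : ℝ => Real.exp (2 * t)) atBot (𝓝 0) :=
  Real.tendsto_exp_atBot.comp (tendsto_id.const_mul_atBot two_pos)

lemma tendsto_besselCore_exp_atBot {ρ : ℝ} (hρ : 0 < ρ) (c : ℝ) :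
    Tendsto (fun t => besselCore ρ (c * Real.exp (2 * t) / 4)) atBot
      (𝓝 (Real.Gamma (ρ + 1))⁻¹) := by
  rw [← besselCore_zero]
  refine (hasDerivAt_besselCore hρ 0).continuousAt.tendsto.comp ?_
  simpa using (tendsto_exp_two_mul_atBot.const_mul c).div_const 4

lemma tendsto_exp_mul_add_atBot {ρ : ℝ} (hρ : 0 < ρ) (a : ℝ) :
    Tendsto (fun t => Real.exp (ρ * (t + a))) atBot (𝓝 0) :=
  Real.tendsto_exp_atBot.comp ((tendsto_atBot_add_const_right _ a tendsto_id).const_mul_atBot hρ)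

lemma tendsto_besselJ_exp_atBot {ρ : ℝ} (hρ : 0 < ρ) :
    Tendsto (fun t => besselJ ρ (ρ * Real.exp t)) atBot (𝓝 0) := by
  simp only [besselJ_mul_exp hρ]
  simpa using (tendsto_exp_mul_add_atBot hρ _).mul (tendsto_besselCore_exp_atBot hρ (ρ ^ 2))

lemma tendsto_besselJExpDeriv_atBot {ρ : ℝ} (hρ : 0 < ρ) :
    Tendsto (besselJExpDeriv ρ) atBot (𝓝 0) := by
  have h1 := (tendsto_besselCore_exp_atBot hρ (ρ ^ 2)).const_mul ρ
  have h2 := tendsto_besselCore_exp_atBot (ρ := ρ + 1) (by positivity) (ρ ^ 2)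
  have h3 := ((tendsto_exp_two_mul_atBot.const_mul (ρ ^ 2)).div_const 4).const_mul 2
  have h := (tendsto_exp_mul_add_atBot hρ (Real.log (ρ / 2))).mul (h1.sub (h3.mul h2))
  rw [zero_mul] at h
  exact h

lemma eventually_besselJ_exp_pos {ρ : ℝ} (hρ : 0 < ρ) :
    ∀ᶠ t in atBot, 0 < besselJ ρ (ρ * Real.exp t) := by
  have h0 : 0 < (Real.Gamma (ρ + 1))⁻¹ := inv_pos.2 (Real.Gamma_pos_of_pos (by positivity))
  filter_upwards [(tendsto_besselCore_exp_atBot hρ (ρ ^ 2)).eventually (lt_mem_nhds h0)] with t ht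
  rw [besselJ_mul_exp hρ]
  positivity

lemma exp_two_mul_le_one {t : ℝ} (ht : t ≤ 0) : Real.exp (2 * t) ≤ 1 :=
  Real.exp_le_one_iff.2 (by linarith)

lemma besselJ_exp_mul_deriv_nonneg {ρ : ℝ} (hρ : 0 < ρ) {t : ℝ} (ht : t ≤ 0) :
    0 ≤ besselJ ρ (ρ * Real.exp t) * besselJExpDeriv ρ t := by
  have hd := fun t => (hasDerivAt_besselJ_exp hρ t).mul (hasDerivAt_besselJExpDeriv hρ t)
  have hmono : MonotoneOn
      ((fun t => besselJ ρ (ρ * Real.exp t)) * besselJExpDeriv ρ) (Iic 0) := by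
    refine monotoneOn_of_hasDerivWithinAt_nonneg (convex_Iic 0)
      (fun t _ => (hd t).continuousAt.continuousWithinAt)
      (fun t _ => (hd t).hasDerivWithinAt) fun t h => ?_
    have h' : t ≤ 0 := (interior_subset h : t ∈ Iic (0 : ℝ))
    have := sub_nonneg.2 (exp_two_mul_le_one h')
    have e : besselJ ρ (ρ * Real.exp t) *
          (ρ ^ 2 * (1 - Real.exp (2 * t)) * besselJ ρ (ρ * Real.exp t)) =
        ρ ^ 2 * (1 - Real.exp (2 * t)) * besselJ ρ (ρ * Real.exp t) ^ 2 := by ring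
    rw [e]
    exact add_nonneg (mul_self_nonneg _) (by positivity)
  have hlim : Tendsto ((fun t => besselJ ρ (ρ * Real.exp t)) * besselJExpDeriv ρ) atBot (𝓝 0) := by
    have := (tendsto_besselJ_exp_atBot hρ).mul (tendsto_besselJExpDeriv_atBot hρ)
    rwa [mul_zero] at this
  refine le_of_tendsto hlim ?_
  filter_upwards [eventually_le_atBot t] with r hr
  exact hmono (hr.trans ht) ht hr

lemma besselJ_exp_pos {ρ : ℝ} (hρ : 0 < ρ) {t : ℝ} (ht : t ≤ 0) :
    0 < besselJ ρ (ρ * Real.exp t) := by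
  have hd := fun t => (hasDerivAt_besselJ_exp hρ t).pow 2
  have hmono : MonotoneOn (fun t => besselJ ρ (ρ * Real.exp t) ^ 2) (Iic 0) := by
    refine monotoneOn_of_hasDerivWithinAt_nonneg (convex_Iic 0)
      (fun t _ => (hd t).continuousAt.continuousWithinAt)
      (fun t _ => (hd t).hasDerivWithinAt) fun t h => ?_
    have := besselJ_exp_mul_deriv_nonneg hρ (interior_subset h : t ∈ Iic (0 : ℝ))
    norm_num
    nlinarith
  by_contra! hneg
  obtain ⟨T, hTt, hT⟩ :=
    ((eventually_le_atBot t).and (eventually_besselJ_exp_pos hρ)).exists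
  obtain ⟨c, hc, hc0⟩ := intermediate_value_Icc' hTt
    (f := fun t => besselJ ρ (ρ * Real.exp t))
    (fun t _ => (hasDerivAt_besselJ_exp hρ t).continuousAt.continuousWithinAt) ⟨hneg, hT.le⟩
  have := hmono (hTt.trans ht) (hc.2.trans ht) hc.1
  simp only at hc0 this
  rw [hc0] at this
  nlinarith

lemma besselJExpDeriv_nonneg {ρ : ℝ} (hρ : 0 < ρ) {t : ℝ} (ht : t ≤ 0) :
    0 ≤ besselJExpDeriv ρ t :=
  nonneg_of_mul_nonneg_right (besselJ_exp_mul_deriv_nonneg hρ ht) (besselJ_exp_pos hρ ht)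

/-- The function `√(1 - e²ᵗ)`. -/
noncomputable def sqrtOneSubExp (t : ℝ) : ℝ := √(1 - Real.exp (2 * t))

lemma sqrtOneSubExp_pos {t : ℝ} (ht : t < 0) : 0 < sqrtOneSubExp t :=
  Real.sqrt_pos.2 (sub_pos.2 (Real.exp_lt_one_iff.2 (by linarith)))

lemma sqrtOneSubExp_sq {t : ℝ} (ht : t < 0) : sqrtOneSubExp t ^ 2 = 1 - Real.exp (2 * t) :=
  Real.sq_sqrt (sub_nonneg.2 (exp_two_mul_le_one ht.le))

lemma hasDerivAt_sqrtOneSubExp {t : ℝ} (ht : t < 0) :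
    HasDerivAt sqrtOneSubExp ((sqrtOneSubExp t ^ 2 - 1) / sqrtOneSubExp t) t := by
  have h0 : 0 < 1 - Real.exp (2 * t) := sub_pos.2 (Real.exp_lt_one_iff.2 (by linarith))
  refine (((hasDerivAt_exp_two_mul t).const_sub 1).sqrt h0.ne').congr_deriv ?_
  rw [sqrtOneSubExp_sq ht]
  have := sqrtOneSubExp_pos ht
  change _ / (2 * sqrtOneSubExp t) = _
  field_simp
  ring

lemma tendsto_sqrtOneSubExp_atBot : Tendsto sqrtOneSubExp atBot (𝓝 1) := by
  have h := (tendsto_exp_two_mul_atBot.const_sub 1).sqrt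
  rw [sub_zero, Real.sqrt_one] at h
  exact h

/-- The logarithm of the Liouville–Green approximation to the recessive solution of
`D²y = ρ² (1 - e²ᵗ) y`. -/
noncomputable def debyePhase (ρ t : ℝ) : ℝ :=
  ρ * (sqrtOneSubExp t - Real.log (1 + sqrtOneSubExp t) + t) - Real.log (sqrtOneSubExp t) / 2

/-- The derivative of `debyePhase`. -/
noncomputable def debyeSlope (ρ t : ℝ) : ℝ :=
  ρ * sqrtOneSubExp t + ((sqrtOneSubExp t ^ 2)⁻¹ - 1) / 2

lemma hasDerivAt_debyePhase (ρ : ℝ) {t : ℝ} (ht : t < 0) :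
    HasDerivAt (debyePhase ρ) (debyeSlope ρ t) t := by
  have hs := sqrtOneSubExp_pos ht
  have hd := hasDerivAt_sqrtOneSubExp ht
  have h := (((hd.sub ((hd.const_add 1).log (by positivity))).add (hasDerivAt_id t)).const_mul
    ρ).sub ((hd.log hs.ne').div_const 2)
  refine h.congr_deriv ?_
  rw [debyeSlope]
  field_simp
  ring

lemma hasDerivAt_debyeSlope (ρ : ℝ) {t : ℝ} (ht : t < 0) :
    HasDerivAt (debyeSlope ρ)
      ((ρ - (sqrtOneSubExp t ^ 3)⁻¹) * ((sqrtOneSubExp t ^ 2 - 1) / sqrtOneSubExp t)) t := by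
  have hs := sqrtOneSubExp_pos ht
  have hd := hasDerivAt_sqrtOneSubExp ht
  have h := (hd.const_mul ρ).add ((((hd.pow 2).inv (pow_pos hs 2).ne').sub_const 1).div_const 2)
  refine h.congr_deriv ?_
  simp only [Pi.pow_apply]
  field_simp
  ring

lemma debyeSlope_riccati (ρ : ℝ) {t : ℝ} (ht : t < 0) :
    ρ ^ 2 * (1 - Real.exp (2 * t)) ≤
      (ρ - (sqrtOneSubExp t ^ 3)⁻¹) * ((sqrtOneSubExp t ^ 2 - 1) / sqrtOneSubExp t) +
        debyeSlope ρ t ^ 2 := by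
  have hs := sqrtOneSubExp_pos ht
  have h1 : 0 ≤ 1 - sqrtOneSubExp t ^ 2 := by
    rw [sqrtOneSubExp_sq ht]; linarith [Real.exp_pos (2 * t)]
  rw [← sqrtOneSubExp_sq ht, debyeSlope, ← sub_nonneg]
  set s := sqrtOneSubExp t
  have e : (ρ - (s ^ 3)⁻¹) * ((s ^ 2 - 1) / s) + (ρ * s + ((s ^ 2)⁻¹ - 1) / 2) ^ 2 -
      ρ ^ 2 * s ^ 2 = (1 - s ^ 2) / s ^ 4 + ((1 - s ^ 2) / (2 * s ^ 2)) ^ 2 := by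
    field_simp
    ring
  rw [e]
  positivity

lemma tendsto_debyePhase_sub_atBot (ρ : ℝ) :
    Tendsto (fun t => debyePhase ρ t - ρ * t) atBot (𝓝 (ρ * (1 - Real.log 2))) := by
  have hs := tendsto_sqrtOneSubExp_atBot
  have h1 : Tendsto (fun t => Real.log (1 + sqrtOneSubExp t)) atBot (𝓝 (Real.log 2)) := by
    have := (hs.const_add 1).log (by norm_num)
    norm_num at this
    exact this
  have h2 := (hs.log one_ne_zero).div_const 2
  have h3 := ((hs.sub h1).const_mul ρ).sub h2
  simp only [Real.log_one, zero_div, sub_zero] at h3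
  refine h3.congr fun t => ?_
  rw [debyePhase]
  ring

lemma tendsto_debyeSlope_atBot (ρ : ℝ) : Tendsto (debyeSlope ρ) atBot (𝓝 ρ) := by
  have hs := tendsto_sqrtOneSubExp_atBot
  have h := (hs.const_mul ρ).add ((((hs.pow 2).inv₀ (by norm_num)).sub_const 1).div_const 2)
  norm_num at h
  exact h

lemma tendsto_exp_debyePhase_atBot {ρ : ℝ} (hρ : 0 < ρ) :
    Tendsto (fun t => Real.exp (debyePhase ρ t)) atBot (𝓝 0) := by
  refine Real.tendsto_exp_atBot.comp ?_
  simpa using (tendsto_debyePhase_sub_atBot ρ).add_atBot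
    ((tendsto_id (α := ℝ)).const_mul_atBot hρ)

lemma besselJExpDeriv_le_debyeSlope_mul {ρ : ℝ} (hρ : 0 < ρ) {t : ℝ} (ht : t < 0) :
    besselJExpDeriv ρ t ≤ debyeSlope ρ t * besselJ ρ (ρ * Real.exp t) := by
  have hd := fun (t : ℝ) (ht : t < 0) => ((hasDerivAt_besselJExpDeriv hρ t).sub
    ((hasDerivAt_debyeSlope ρ ht).mul (hasDerivAt_besselJ_exp hρ t))).mul
      (hasDerivAt_debyePhase ρ ht).exp
  have hanti := antitoneOn_of_hasDerivWithinAt_nonpos (convex_Iio 0)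
    (fun t ht => (hd t ht).continuousAt.continuousWithinAt)
    (fun t ht => (hd t (interior_subset ht : t ∈ Iio (0 : ℝ))).hasDerivWithinAt) fun t h => by
      have h' : t < 0 := (interior_subset h : t ∈ Iio (0 : ℝ))
      have hr := mul_le_mul_of_nonneg_right (debyeSlope_riccati ρ h')
        (mul_pos (besselJ_exp_pos hρ h'.le) (Real.exp_pos (debyePhase ρ t))).le
      simp only [Pi.sub_apply, Pi.mul_apply]
      linarith
  have hlim := ((tendsto_besselJExpDeriv_atBot hρ).sub
    ((tendsto_debyeSlope_atBot ρ).mul (tendsto_besselJ_exp_atBot hρ))).mul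
      (tendsto_exp_debyePhase_atBot hρ)
  rw [mul_zero] at hlim
  have h := ge_of_tendsto hlim (b := (besselJExpDeriv ρ t -
      debyeSlope ρ t * besselJ ρ (ρ * Real.exp t)) * Real.exp (debyePhase ρ t)) (by
    filter_upwards [eventually_le_atBot t] with r hr
    exact hanti (hr.trans_lt ht) ht hr)
  have := nonpos_of_mul_nonpos_left h (Real.exp_pos _)
  linarith

lemma besselJ_exp_le_debye {ρ : ℝ} (hρ : 0 < ρ) {t : ℝ} (ht : t < 0) :
    besselJ ρ (ρ * Real.exp t) ≤ Real.exp (1 / 2) / √ρ * Real.exp (debyePhase ρ t) := by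
  have hd := fun (t : ℝ) (ht : t < 0) => (hasDerivAt_besselJ_exp hρ t).mul
    (hasDerivAt_debyePhase ρ ht).neg.exp
  have hanti := antitoneOn_of_hasDerivWithinAt_nonpos (convex_Iio 0)
    (fun t ht => (hd t ht).continuousAt.continuousWithinAt)
    (fun t ht => (hd t (interior_subset ht : t ∈ Iio (0 : ℝ))).hasDerivWithinAt) fun t h => by
      have h' : t < 0 := (interior_subset h : t ∈ Iio (0 : ℝ))
      have hr := mul_le_mul_of_nonneg_right (besselJExpDeriv_le_debyeSlope_mul hρ h')
        (Real.exp_pos (-debyePhase ρ t)).le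
      simp only [Pi.neg_apply]
      linarith
  have hlim : Tendsto (fun t => besselJ ρ (ρ * Real.exp t) * Real.exp (-debyePhase ρ t)) atBot
      (𝓝 ((Real.Gamma (ρ + 1))⁻¹ * Real.exp (ρ * Real.log ρ - ρ))) := by
    have h1 := ((tendsto_debyePhase_sub_atBot ρ).const_sub (ρ * Real.log (ρ / 2))).rexp
    have e : ρ * Real.log (ρ / 2) - ρ * (1 - Real.log 2) = ρ * Real.log ρ - ρ := by
      rw [Real.log_div hρ.ne' two_ne_zero]; ring
    rw [e] at h1
    refine ((tendsto_besselCore_exp_atBot hρ (ρ ^ 2)).mul h1).congr fun t => ?_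
    rw [besselJ_mul_exp hρ, mul_comm (Real.exp _) (besselCore _ _), mul_assoc, ← Real.exp_add]
    ring_nf
  have h := ge_of_tendsto hlim
    (b := besselJ ρ (ρ * Real.exp t) * Real.exp (-debyePhase ρ t)) (by
    filter_upwards [eventually_le_atBot t] with r hr
    exact hanti (hr.trans_lt ht) ht hr)
  have hG : (Real.Gamma (ρ + 1))⁻¹ * Real.exp (ρ * Real.log ρ - ρ) ≤ Real.exp (1 / 2) / √ρ := by
    have hs : 0 < √ρ := Real.sqrt_pos.2 hρ
    rw [inv_mul_le_iff₀ (Real.Gamma_pos_of_pos (by positivity)), mul_div_assoc', le_div_iff₀ hs]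
    have := mul_le_mul_of_nonneg_right (sqrt_mul_exp_le_Gamma hρ) (Real.exp_pos (1 / 2)).le
    rw [mul_assoc, ← Real.exp_add, sub_add_cancel] at this
    linarith
  have h2 := mul_le_mul_of_nonneg_right (h.trans hG) (Real.exp_pos (debyePhase ρ t)).le
  rwa [mul_assoc, ← Real.exp_add, neg_add_cancel, Real.exp_zero, mul_one] at h2

/-- Growth bound for the energy `l² y² + (Dy)²` of a solution of `D²y = q y` with `|q| ≤ M l²`. -/
lemma energy_le_mul_exp {y p q : ℝ → ℝ} {l M d : ℝ} (hl : 0 < l)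
    (hy : ∀ t, HasDerivAt y (p t) t) (hp : ∀ t, HasDerivAt p (q t * y t) t)
    (hq : ∀ t ∈ Icc (-d) d, |q t| ≤ M * l ^ 2) {a b : ℝ} (ha : a ∈ Icc (-d) d)
    (hb : b ∈ Icc (-d) d) :
    l ^ 2 * y b ^ 2 + p b ^ 2 ≤
      (l ^ 2 * y a ^ 2 + p a ^ 2) * Real.exp ((1 + M) * l * |b - a|) := by
  set k := (1 + M) * l
  set E : ℝ → ℝ := fun t => l ^ 2 * y t ^ 2 + p t ^ 2
  set E' : ℝ → ℝ := fun t => 2 * l ^ 2 * y t * p t + 2 * p t * (q t * y t)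
  have hE : ∀ t, HasDerivAt E (E' t) t := fun t => by
    refine ((((hy t).pow 2).const_mul (l ^ 2)).add ((hp t).pow 2)).congr_deriv ?_
    simp only [E', Nat.cast_ofNat, Nat.add_one_sub_one, pow_one]
    ring
  have hbound : ∀ t ∈ Icc (-d) d, |E' t| ≤ k * E t := fun t ht => by
    have h1 : 2 * (l * |y t|) * |p t| ≤ E t := by
      have := two_mul_le_add_sq (l * |y t|) |p t|
      rwa [mul_pow, sq_abs, sq_abs] at this
    have hM : 0 ≤ M := by
      have := (abs_nonneg _).trans (hq t ht)
      exact nonneg_of_mul_nonneg_left this (by positivity)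
    calc |E' t| = |2 * y t * p t * (l ^ 2 + q t)| := by simp only [E']; ring_nf
      _ = 2 * |y t| * |p t| * |l ^ 2 + q t| := by simp [abs_mul]
      _ ≤ 2 * |y t| * |p t| * (l ^ 2 + M * l ^ 2) := by
        gcongr
        refine (abs_add_le _ _).trans ?_
        rw [abs_of_nonneg (sq_nonneg l)]
        linarith [hq t ht]
      _ = k * (2 * (l * |y t|) * |p t|) := by simp only [k]; ring
      _ ≤ k * E t := by gcongr
  have hexp : ∀ c t : ℝ, HasDerivAt (fun t => Real.exp (c * t)) (c * Real.exp (c * t)) t :=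
    fun c t => by simpa [mul_comm] using ((hasDerivAt_id t).const_mul c).exp
  rcases le_total a b with hab | hab
  · have hd := fun t => (hE t).mul (hexp (-k) t)
    have hanti := antitoneOn_of_hasDerivWithinAt_nonpos (convex_Icc (-d) d)
      (fun t _ => (hd t).continuousAt.continuousWithinAt)
      (fun t _ => (hd t).hasDerivWithinAt) fun t ht => by
        have := mul_le_mul_of_nonneg_right ((le_abs_self _).trans (hbound t (interior_subset ht)))
          (Real.exp_pos (-k * t)).le
        linarith
    have h : E b * Real.exp (-k * b) ≤ E a * Real.exp (-k * a) := hanti ha hb hab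
    have h2 := mul_le_mul_of_nonneg_right h (Real.exp_pos (k * b)).le
    rw [mul_assoc (E b), mul_assoc (E a), ← Real.exp_add, ← Real.exp_add, ← add_mul, neg_add_cancel, zero_mul,
      Real.exp_zero, mul_one] at h2
    rw [abs_of_nonneg (sub_nonneg.2 hab)]
    rwa [show -k * a + k * b = k * (b - a) by ring] at h2
  · have hd := fun t => (hE t).mul (hexp k t)
    have hmono := monotoneOn_of_hasDerivWithinAt_nonneg (convex_Icc (-d) d)
      (fun t _ => (hd t).continuousAt.continuousWithinAt)
      (fun t _ => (hd t).hasDerivWithinAt) fun t ht => by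
        have := mul_le_mul_of_nonneg_right
          ((neg_le_abs _).trans (hbound t (interior_subset ht))) (Real.exp_pos (k * t)).le
        linarith
    have h : E b * Real.exp (k * b) ≤ E a * Real.exp (k * a) := hmono hb ha hab
    have h2 := mul_le_mul_of_nonneg_right h (Real.exp_pos (-k * b)).le
    rw [mul_assoc (E b), mul_assoc (E a), ← Real.exp_add, ← Real.exp_add, ← add_mul, add_neg_cancel, zero_mul,
      Real.exp_zero, mul_one] at h2
    rw [abs_of_nonpos (sub_nonpos.2 hab)]
    rwa [show k * a + -k * b = k * -(b - a) by ring] at h2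

lemma two_mul_le_log_sub_log {s : ℝ} (h0 : 0 ≤ s) (h1 : s < 1) :
    2 * s ≤ Real.log (1 + s) - Real.log (1 - s) := by
  have h := Real.hasSum_log_sub_log_of_abs_lt_one (abs_lt.2 ⟨by linarith, h1⟩)
  simpa using sum_le_hasSum {0} (fun k _ => by positivity) h

section TransitionPoint

variable {r t : ℝ}

lemma sqrtOneSubExp_half_log (hr : 1 < r) :
    sqrtOneSubExp (Real.log (1 - (r ^ 2)⁻¹) / 2) = r⁻¹ := by
  have h : (r ^ 2)⁻¹ < 1 := inv_lt_one_of_one_lt₀ (one_lt_pow₀ hr two_ne_zero)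
  rw [sqrtOneSubExp, mul_div_cancel₀ _ two_ne_zero, Real.exp_log (by linarith), sub_sub_cancel,
    ← inv_pow, Real.sqrt_sq (by positivity)]

lemma half_log_neg (hr : 1 < r) : Real.log (1 - (r ^ 2)⁻¹) / 2 < 0 := by
  have h : (r ^ 2)⁻¹ < 1 := inv_lt_one_of_one_lt₀ (one_lt_pow₀ hr two_ne_zero)
  have h' : 0 < (r ^ 2)⁻¹ := by positivity
  linarith [Real.log_neg (x := 1 - (r ^ 2)⁻¹) (by linarith) (by linarith)]

lemma besselJ_half_log_le (hr : 1 < r) :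
    besselJ (r ^ 3) (r ^ 3 * Real.exp (Real.log (1 - (r ^ 2)⁻¹) / 2)) ≤
      Real.exp (1 / 2) / r := by
  have hr0 : 0 < r := by linarith
  have hr1 : r⁻¹ < 1 := inv_lt_one_of_one_lt₀ hr
  have hri : 0 < r⁻¹ := by positivity
  refine (besselJ_exp_le_debye (pow_pos hr0 3) (half_log_neg hr)).trans ?_
  have hphase : debyePhase (r ^ 3) (Real.log (1 - (r ^ 2)⁻¹) / 2) ≤ Real.log r / 2 := by
    have hfac : 1 - (r ^ 2)⁻¹ = (1 + r⁻¹) * (1 - r⁻¹) := by rw [← inv_pow]; ring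
    rw [debyePhase, sqrtOneSubExp_half_log hr, hfac,
      Real.log_mul (by positivity) (sub_pos.2 hr1).ne', Real.log_inv]
    have h1 := two_mul_le_log_sub_log hri.le hr1
    have h2 : r ^ 3 * (r⁻¹ - Real.log (1 + r⁻¹) +
        (Real.log (1 + r⁻¹) + Real.log (1 - r⁻¹)) / 2) ≤ 0 :=
      mul_nonpos_of_nonneg_of_nonpos (by positivity) (by linarith)
    linarith
  have hsqrt : √(r ^ 3) = r * √r := by
    rw [show r ^ 3 = r ^ 2 * r by ring, Real.sqrt_mul (by positivity), Real.sqrt_sq hr0.le]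
  have hexp : Real.exp (Real.log r / 2) = √r := by
    rw [Real.exp_half, Real.exp_log hr0]
  calc _ ≤ Real.exp (1 / 2) / √(r ^ 3) * Real.exp (Real.log r / 2) := by gcongr
    _ = Real.exp (1 / 2) / r := by
      have := Real.sqrt_pos.2 hr0
      rw [hsqrt, hexp]
      field_simp

lemma besselJExpDeriv_half_log_le (hr : 1 < r) :
    besselJExpDeriv (r ^ 3) (Real.log (1 - (r ^ 2)⁻¹) / 2) ≤
      3 / 2 * r ^ 2 * besselJ (r ^ 3) (r ^ 3 * Real.exp (Real.log (1 - (r ^ 2)⁻¹) / 2)) := by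
  have hr0 : 0 < r := by linarith
  have ht := half_log_neg hr
  refine (besselJExpDeriv_le_debyeSlope_mul (pow_pos hr0 3) ht).trans ?_
  refine mul_le_mul_of_nonneg_right ?_ (besselJ_exp_pos (pow_pos hr0 3) ht.le).le
  rw [debyeSlope, sqrtOneSubExp_half_log hr, inv_pow, inv_inv,
    show r ^ 3 * r⁻¹ = r ^ 2 by field_simp]
  linarith

lemma energy_half_log_le (hr : 1 < r) :
    (r ^ 2) ^ 2 * besselJ (r ^ 3) (r ^ 3 * Real.exp (Real.log (1 - (r ^ 2)⁻¹) / 2)) ^ 2 +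
      besselJExpDeriv (r ^ 3) (Real.log (1 - (r ^ 2)⁻¹) / 2) ^ 2 ≤
        13 / 4 * Real.exp 1 * r ^ 2 := by
  have hr0 : 0 < r := by linarith
  have ht := (half_log_neg hr).le
  have h1 := pow_le_pow_left₀ (besselJExpDeriv_nonneg (pow_pos hr0 3) ht)
    (besselJExpDeriv_half_log_le hr) 2
  have h2 := pow_le_pow_left₀ (besselJ_exp_pos (pow_pos hr0 3) ht).le (besselJ_half_log_le hr) 2
  rw [div_pow, ← Real.exp_nat_mul, show ((2 : ℕ) : ℝ) * (1 / 2) = 1 by norm_num,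
    le_div_iff₀ (by positivity)] at h2
  have h3 := mul_le_mul_of_nonneg_left h2 (by positivity : 0 ≤ 13 / 4 * r ^ 2)
  linarith

lemma abs_half_log_le (hr : 2 ≤ r ^ 2) : |Real.log (1 - (r ^ 2)⁻¹) / 2| ≤ 1 / r ^ 2 := by
  have hh : 0 < (r ^ 2)⁻¹ := by positivity
  have hh2 : (r ^ 2)⁻¹ ≤ 1 / 2 := by rw [one_div]; gcongr
  have h0 : 0 < 1 - (r ^ 2)⁻¹ := by linarith
  have h1 := Real.one_sub_inv_le_log_of_pos h0
  have h2 := Real.log_le_sub_one_of_pos h0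
  have h3 : (1 - (r ^ 2)⁻¹)⁻¹ ≤ 1 + 2 * (r ^ 2)⁻¹ := by
    rw [inv_le_iff_one_le_mul₀ h0]
    nlinarith
  rw [one_div, abs_le]
  constructor <;> linarith

lemma abs_log_le_two_mul {u e : ℝ} (he : e ≤ 1 / 2) (hu : |u - 1| ≤ e) :
    |Real.log u| ≤ 2 * e := by
  obtain ⟨hu1, hu2⟩ := abs_le.1 hu
  have h0 : 0 < u := by linarith
  have h1 := Real.one_sub_inv_le_log_of_pos h0
  have h2 := Real.log_le_sub_one_of_pos h0
  have h3 : u⁻¹ ≤ 1 + 2 * e := by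
    rw [inv_le_iff_one_le_mul₀ h0]
    nlinarith
  rw [abs_le]
  constructor <;> linarith

/-- Bound for `J_ρ(ρ eᵗ)` with `ρ = r³` in the transition region `|t| ≤ D r⁻²`. -/
lemma abs_besselJ_exp_le {D : ℝ} (hD : 1 ≤ D) (hr1 : 1 < r) (hr : 2 * D ≤ r ^ 2)
    (ht : |t| ≤ D / r ^ 2) :
    |besselJ (r ^ 3) (r ^ 3 * Real.exp t)| ≤
      √(13 / 4 * Real.exp 1 * Real.exp ((1 + 4 * D) * (2 * D))) * r⁻¹ := by
  have hr0 : 0 < r := by linarith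
  have hρ : 0 < r ^ 3 := by positivity
  have ht0 : |Real.log (1 - (r ^ 2)⁻¹) / 2| ≤ D / r ^ 2 :=
    (abs_half_log_le (by linarith)).trans (by gcongr)
  have hq : ∀ t ∈ Icc (-(D / r ^ 2)) (D / r ^ 2),
      |(r ^ 3) ^ 2 * (1 - Real.exp (2 * t))| ≤ 4 * D * (r ^ 2) ^ 2 := fun t ht => by
    have ht' : |2 * t| ≤ 2 * (D / r ^ 2) := by
      rw [abs_mul, abs_two]
      linarith [abs_le.2 ht]
    have hd : 2 * (D / r ^ 2) ≤ 1 := by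
      rw [mul_div_assoc']
      exact div_le_one_of_le₀ hr (by positivity)
    have := Real.abs_exp_sub_one_le (ht'.trans hd)
    rw [abs_mul, abs_of_nonneg (by positivity), abs_sub_comm]
    calc (r ^ 3) ^ 2 * |Real.exp (2 * t) - 1| ≤ (r ^ 3) ^ 2 * (2 * (2 * (D / r ^ 2))) := by
          gcongr
          linarith
      _ = 4 * D * (r ^ 2) ^ 2 := by
          field_simp
          ring
  have hE := energy_le_mul_exp (l := r ^ 2) (by positivity) (hasDerivAt_besselJ_exp hρ)
    (hasDerivAt_besselJExpDeriv hρ) hq (abs_le.1 ht0) (abs_le.1 ht)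
  set t₀ := Real.log (1 - (r ^ 2)⁻¹) / 2
  have hdist : (1 + 4 * D) * r ^ 2 * |t - t₀| ≤ (1 + 4 * D) * (2 * D) := by
    rw [mul_assoc]
    refine mul_le_mul_of_nonneg_left ?_ (by positivity)
    have h := (abs_sub t t₀).trans (add_le_add ht ht0)
    calc r ^ 2 * |t - t₀| ≤ r ^ 2 * (D / r ^ 2 + D / r ^ 2) := by gcongr
      _ = 2 * D := by
        field_simp
        ring
  have hfin : (r ^ 2 * besselJ (r ^ 3) (r ^ 3 * Real.exp t)) ^ 2 ≤
      13 / 4 * Real.exp 1 * Real.exp ((1 + 4 * D) * (2 * D)) * r ^ 2 := by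
    have h1 := mul_le_mul (energy_half_log_le hr1) (Real.exp_le_exp.2 hdist) (Real.exp_pos _).le
      (by positivity)
    have h2 := sq_nonneg (besselJExpDeriv (r ^ 3) t)
    linarith
  have habs := Real.abs_le_sqrt hfin
  rw [Real.sqrt_mul (by positivity), Real.sqrt_sq hr0.le, abs_mul,
    abs_of_nonneg (by positivity)] at habs
  rw [← div_eq_mul_inv, le_div_iff₀ hr0]
  refine le_of_mul_le_mul_right ?_ hr0
  linarith

end TransitionPoint

/-- For every `C > 0` there exist `K > 0`, `ρ₀ > 0` (depending only
on `C`) such that for all real `ρ ≥ ρ₀` and `x > 0` with `|x - ρ| ≤ C ρ^{1/3}`, one has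
`|J_ρ(x)| ≤ K ρ^{-1/3}`. -/
theorem besselJ_transition_bound (C : ℝ) (hC : 0 < C) :
    ∃ K ρ₀ : ℝ, 0 < K ∧ 0 < ρ₀ ∧
      ∀ ρ x : ℝ, ρ₀ ≤ ρ → 0 < x → |x - ρ| ≤ C * ρ ^ ((1 : ℝ) / 3) →
        |besselJ ρ x| ≤ K * ρ ^ (-(1 : ℝ) / 3) := by
  set D := 2 * C + 1 with hD
  refine ⟨√(13 / 4 * Real.exp 1 * Real.exp ((1 + 4 * D) * (2 * D))), (2 * D) ^ 3, by positivity,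
    by positivity, fun ρ x hρ hx hxρ => ?_⟩
  have hρ0 : 0 < ρ := lt_of_lt_of_le (by positivity) hρ
  set r := ρ ^ ((1 : ℝ) / 3) with hrdef
  have hr0 : 0 < r := by positivity
  have hr3 : r ^ 3 = ρ := by
    rw [hrdef, ← Real.rpow_natCast, ← Real.rpow_mul hρ0.le]
    norm_num
  have hrD : 2 * D ≤ r := le_of_pow_le_pow_left₀ three_ne_zero hr0.le (hr3.symm ▸ hρ)
  have hr1 : 1 < r := by linarith
  have hr2 : 2 * D ≤ r ^ 2 := hrD.trans (by nlinarith)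
  have hinv : ρ ^ (-(1 : ℝ) / 3) = r⁻¹ := by rw [neg_div, Real.rpow_neg hρ0.le]
  have hxe : x = r ^ 3 * Real.exp (Real.log (x / ρ)) := by
    rw [Real.exp_log (by positivity), hr3]
    field_simp
  have hu : |x / ρ - 1| ≤ C / r ^ 2 := by
    rw [show x / ρ - 1 = (x - ρ) / ρ by field_simp, abs_div, abs_of_pos hρ0,
      div_le_div_iff₀ hρ0 (by positivity), ← hr3]
    rw [← hr3] at hxρ
    calc |x - r ^ 3| * r ^ 2 ≤ C * r * r ^ 2 := by gcongr
      _ = C * r ^ 3 := by ring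
  have ht : |Real.log (x / ρ)| ≤ D / r ^ 2 := by
    refine (abs_log_le_two_mul ?_ hu).trans ?_
    · rw [div_le_iff₀ (by positivity)]
      linarith
    · rw [mul_div_assoc']
      gcongr
      linarith
  have := abs_besselJ_exp_le (by linarith) hr1 hr2 ht
  rwa [← hxe, hr3, ← hinv] at this
end
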